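/- A finite simple graph G is very well-covered if and only if G is a well-covered König-Egerváry graph with no isolated vertices. -/

import Mathlib

open Classical

variable {V : Type*} [Fintype V] [DecidableEq V]

/-- `S` is a stable (independent) set of vertices in `G`. -/
def IsStable (G : SimpleGraph V) (S : Finset V) : Prop :=
  ∀ ⦃x⦄, x ∈ S → ∀ ⦃y⦄, y ∈ S → ¬G.Adj x y

/-- The open neighborhood `N(S)`: vertices outside `S` having a neighbor in `S`. -/
noncomputable def nbhd (G : SimpleGraph V) (S : Finset V) : Finset V :=
  Finset.univ.filter fun v => v ∉ S ∧ ∃ u ∈ S, G.Adj u v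

/-- The closed neighborhood `N[S] = S ∪ N(S)`. -/
noncomputable def closedNbhd (G : SimpleGraph V) (S : Finset V) : Finset V :=
  S ∪ nbhd G S

/-- The stability (independence) number of the subgraph of `G` induced by `A`. -/
noncomputable def alphaOn (G : SimpleGraph V) (A : Finset V) : ℕ :=
  sSup {n | ∃ S ⊆ A, IsStable G S ∧ S.card = n}

/-- The stability (independence) number `α(G)`. -/
noncomputable def alpha (G : SimpleGraph V) : ℕ :=
  alphaOn G Finset.univ

/-- `S` is a maximum stable set of the subgraph of `G` induced by `N[S]`. -/
def IsLocalMaxStable (G : SimpleGraph V) (S : Finset V) : Prop :=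
  IsStable G S ∧ S.card = alphaOn G (closedNbhd G S)

/-- `Ψ(G)`: the family of all local maximum stable sets of `G`. -/
def Psi (G : SimpleGraph V) : Set (Finset V) :=
  {S | IsLocalMaxStable G S}

/-- A matching of `G`: a set of pairwise disjoint edges of `G`. -/
def IsGMatching (G : SimpleGraph V) (M : Finset (Sym2 V)) : Prop :=
  (∀ e ∈ M, e ∈ G.edgeSet) ∧
    ∀ e ∈ M, ∀ f ∈ M, e ≠ f → ∀ v : V, v ∈ e → v ∉ f

/-- A matching of `G` all of whose edges have both endpoints inside `A`,
i.e. a matching of the subgraph of `G` induced by `A`. -/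
def IsGMatchingOn (G : SimpleGraph V) (A : Finset V) (M : Finset (Sym2 V)) : Prop :=
  IsGMatching G M ∧ ∀ e ∈ M, ∀ v : V, v ∈ e → v ∈ A

/-- The matching number of the subgraph of `G` induced by `A`. -/
noncomputable def muOn (G : SimpleGraph V) (A : Finset V) : ℕ :=
  sSup {n | ∃ M, IsGMatchingOn G A M ∧ M.card = n}

/-- The matching number `μ(G)`. -/
noncomputable def mu (G : SimpleGraph V) : ℕ :=
  muOn G Finset.univ

/-- A maximum matching of `G`. -/
def IsMaximumGMatching (G : SimpleGraph V) (M : Finset (Sym2 V)) : Prop :=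
  IsGMatching G M ∧ M.card = mu G

/-- The matching `M` saturates the vertex `v`. -/
def MSaturates (M : Finset (Sym2 V)) (v : V) : Prop :=
  ∃ e ∈ M, v ∈ e

/-- A perfect matching of `G`: a matching saturating every vertex. -/
def IsPerfectGMatching (G : SimpleGraph V) (M : Finset (Sym2 V)) : Prop :=
  IsGMatching G M ∧ ∀ v : V, MSaturates M v

/-- The set of vertices saturated by `M`. -/
noncomputable def msupp (M : Finset (Sym2 V)) : Finset V :=
  Finset.univ.filter fun v => ∃ e ∈ M, v ∈ e

/-- `M` is a uniquely restricted matching: it is the unique perfect matching of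
the subgraph of `G` induced by the set of vertices saturated by `M`. -/
def UniquelyRestricted (G : SimpleGraph V) (M : Finset (Sym2 V)) : Prop :=
  IsGMatching G M ∧
    ∀ M' : Finset (Sym2 V), IsGMatchingOn G (msupp M) M' →
      (∀ v ∈ msupp M, MSaturates M' v) → M' = M

/-- Accessibility property of a set system. -/
def AccessibleFam (F : Set (Finset V)) : Prop :=
  ∀ X ∈ F, X ≠ ∅ → ∃ x ∈ X, X.erase x ∈ F

/-- Exchange property of a set system. -/
def ExchangeFam (F : Set (Finset V)) : Prop :=
  ∀ X ∈ F, ∀ Y ∈ F, X.card = Y.card + 1 → ∃ x ∈ X, x ∉ Y ∧ insert x Y ∈ F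

/-- A greedoid: a nonempty set system satisfying accessibility and exchange. -/
def IsGreedoidFam (F : Set (Finset V)) : Prop :=
  F.Nonempty ∧ AccessibleFam F ∧ ExchangeFam F

/-- A maximal stable set. -/
def IsMaximalStable (G : SimpleGraph V) (S : Finset V) : Prop :=
  IsStable G S ∧ ∀ T, IsStable G T → S ⊆ T → S = T

/-- `G` is well-covered: all maximal stable sets have the same cardinality. -/
def WellCovered (G : SimpleGraph V) : Prop :=
  ∀ S T, IsMaximalStable G S → IsMaximalStable G T → S.card = T.card

/-- `G` is very well-covered: well-covered, no isolated vertices, `|V| = 2α(G)`. -/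
def VeryWellCovered (G : SimpleGraph V) : Prop :=
  WellCovered G ∧ (∀ v : V, ∃ u, G.Adj v u) ∧ Fintype.card V = 2 * alpha G

/-- The subgraph of `G` induced by `A` is a König-Egerváry graph. -/
def KonigEgervaryOn (G : SimpleGraph V) (A : Finset V) : Prop :=
  alphaOn G A + muOn G A = A.card

/-- `G` is a König-Egerváry graph: `α(G) + μ(G) = |V(G)|`. -/
def KonigEgervary (G : SimpleGraph V) : Prop :=
  alpha G + mu G = Fintype.card V

/-- The cycle `c` is alternating with respect to `M`: of every two incident
edges of `c` exactly one belongs to `M`. -/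
def IsAlternatingCycle (G : SimpleGraph V) (M : Finset (Sym2 V)) {v : V}
    (c : G.Walk v v) : Prop :=
  c.IsCycle ∧ ∀ e ∈ c.edges, ∀ f ∈ c.edges, e ≠ f →
    (∃ u : V, u ∈ e ∧ u ∈ f) → (e ∈ M ↔ f ∉ M)

/-- `G` contains an `M`-alternating cycle. -/
def HasAlternatingCycle (G : SimpleGraph V) (M : Finset (Sym2 V)) : Prop :=
  ∃ (v : V) (c : G.Walk v v), IsAlternatingCycle G M c

/-- The cycle `c` is chordless: the subgraph induced by its vertices has no
edges other than the cycle edges. -/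
def ChordlessCycle (G : SimpleGraph V) {v : V} (c : G.Walk v v) : Prop :=
  ∀ x ∈ c.support, ∀ y ∈ c.support, G.Adj x y → s(x, y) ∈ c.edges

omit [Fintype V] [DecidableEq V] in
theorem IsStable.mono {G : SimpleGraph V} {S T : Finset V} (hT : IsStable G T) (h : S ⊆ T) :
    IsStable G S :=
  fun _ hx _ hy => hT (h hx) (h hy)

omit [Fintype V] [DecidableEq V] in
theorem isStable_singleton (G : SimpleGraph V) (v : V) : IsStable G {v} := by
  intro x hx y hy
  rw [Finset.mem_singleton] at hx hy
  subst hx hy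
  exact G.irrefl

omit [DecidableEq V] in
theorem IsStable.exists_isMaximalStable {G : SimpleGraph V} {S : Finset V} (hS : IsStable G S) :
    ∃ T, S ⊆ T ∧ IsMaximalStable G T := by
  obtain ⟨T, hST, hT⟩ := (Set.toFinite {T | IsStable G T}).exists_le_maximal hS
  exact ⟨T, hST, hT.prop, fun U hU hTU => hT.eq_of_le hU hTU⟩

omit [DecidableEq V] in
/-- In a well-covered graph every maximal stable set is at least as large as any stable set. -/
theorem WellCovered.card_le {G : SimpleGraph V} (hG : WellCovered G) {S T : Finset V}
    (hS : IsStable G S) (hT : IsMaximalStable G T) : S.card ≤ T.card := by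
  obtain ⟨U, hSU, hU⟩ := hS.exists_isMaximalStable
  exact (Finset.card_le_card hSU).trans (hG U T hU hT).le

theorem mem_nbhd {G : SimpleGraph V} {S : Finset V} {v : V} :
    v ∈ nbhd G S ↔ v ∉ S ∧ ∃ u ∈ S, G.Adj u v := by
  simp [nbhd]

/-- In a well-covered graph without isolated vertices every stable set has at least as many
neighbors as elements. -/
theorem WellCovered.card_le_card_nbhd {G : SimpleGraph V} (hG : WellCovered G)
    (hiso : ∀ v : V, ∃ u, G.Adj v u) {A : Finset V} (hA : IsStable G A) :
    A.card ≤ (nbhd G A).card := by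
  induction A using Finset.strongInduction with
  | H A ih =>
    rcases A.eq_empty_or_nonempty with rfl | ⟨x, hx⟩
    · simp
    obtain ⟨y, hxy⟩ := hiso x
    obtain ⟨T, hyT, hT⟩ := (isStable_singleton G y).exists_isMaximalStable
    rw [Finset.singleton_subset_iff] at hyT
    have hxT : x ∉ T := fun h => hT.1 h hyT hxy
    have hssub : A ∩ T ⊂ A := by
      refine Finset.ssubset_iff_subset_ne.2 ⟨Finset.inter_subset_left, fun h => hxT ?_⟩
      exact (Finset.mem_inter.1 (h ▸ hx)).2
    have hind := ih _ hssub (hA.mono Finset.inter_subset_left)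
    have hsub : nbhd G (A ∩ T) ⊆ nbhd G A \ T := by
      intro v hv
      obtain ⟨-, u, hu, huv⟩ := mem_nbhd.1 hv
      rw [Finset.mem_inter] at hu
      exact Finset.mem_sdiff.2
        ⟨mem_nbhd.2 ⟨fun h => hA hu.1 h huv, u, hu.1, huv⟩, fun h => hT.1 hu.2 h huv⟩
    have hstable : IsStable G (T \ nbhd G A ∪ A \ T) := by
      have hcross : ∀ a ∈ T \ nbhd G A, ∀ b ∈ A \ T, ¬G.Adj b a := by
        intro a ha b hb hba
        rw [Finset.mem_sdiff] at ha hb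
        exact ha.2 (mem_nbhd.2 ⟨fun h => hA hb.1 h hba, b, hb.1, hba⟩)
      intro a ha b hb hab
      rcases Finset.mem_union.1 ha with ha | ha <;> rcases Finset.mem_union.1 hb with hb | hb
      · exact hT.1 (Finset.mem_sdiff.1 ha).1 (Finset.mem_sdiff.1 hb).1 hab
      · exact hcross a ha b hb hab.symm
      · exact hcross b hb a ha hab
      · exact hA (Finset.mem_sdiff.1 ha).1 (Finset.mem_sdiff.1 hb).1 hab
    have hdisj : Disjoint (T \ nbhd G A) (A \ T) :=
      Finset.disjoint_sdiff.mono_left Finset.sdiff_subset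
    have hle := hG.card_le hstable hT
    rw [Finset.card_union_of_disjoint hdisj] at hle
    have hsubcard := Finset.card_le_card hsub
    have h₁ := Finset.card_sdiff_add_card_inter T (nbhd G A)
    have h₂ := Finset.card_sdiff_add_card_inter A T
    have h₃ := Finset.card_sdiff_add_card_inter (nbhd G A) T
    rw [Finset.inter_comm] at h₃
    omega

theorem IsGMatching.two_mul_card_le {G : SimpleGraph V} {M : Finset (Sym2 V)}
    (hM : IsGMatching G M) : 2 * M.card ≤ Fintype.card V := by
  have hcard : (M.biUnion Sym2.toFinset).card = ∑ e ∈ M, e.toFinset.card := by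
    refine Finset.card_biUnion fun e he f hf hef => Finset.disjoint_left.2 fun v hv hv' => ?_
    rw [Sym2.mem_toFinset] at hv hv'
    exact hM.2 e he f hf hef v hv hv'
  rw [Finset.sum_congr rfl fun e he =>
    Sym2.card_toFinset_of_not_isDiag e (G.not_isDiag_of_mem_edgeSet (hM.1 e he))] at hcard
  rw [Finset.sum_const, smul_eq_mul, mul_comm] at hcard
  exact hcard ▸ Finset.card_le_univ _

omit [DecidableEq V] in
theorem exists_isStable_card_eq_alpha (G : SimpleGraph V) :
    ∃ S, IsStable G S ∧ S.card = alpha G := by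
  have hmem : alpha G ∈ {n | ∃ S ⊆ Finset.univ, IsStable G S ∧ S.card = n} := by
    refine Nat.sSup_mem ⟨0, ∅, by simp, by simp [IsStable], rfl⟩ ⟨Fintype.card V, ?_⟩
    rintro _ ⟨S, -, -, rfl⟩
    exact S.card_le_univ
  obtain ⟨S, -, hS⟩ := hmem
  exact ⟨S, hS⟩

theorem card_mem_upperBounds_card_matchings (G : SimpleGraph V) :
    Fintype.card V ∈ upperBounds
      {n | ∃ M, IsGMatchingOn G Finset.univ M ∧ M.card = n} := by
  rintro _ ⟨M, hM, rfl⟩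
  have := hM.1.two_mul_card_le
  omega

theorem two_mul_mu_le_card (G : SimpleGraph V) : 2 * mu G ≤ Fintype.card V := by
  have hmem : mu G ∈ {n | ∃ M, IsGMatchingOn G Finset.univ M ∧ M.card = n} :=
    Nat.sSup_mem ⟨0, ∅, by simp [IsGMatchingOn, IsGMatching], rfl⟩ ⟨_, card_mem_upperBounds_card_matchings G⟩
  obtain ⟨M, hM, hcard⟩ := hmem
  exact hcard ▸ hM.1.two_mul_card_le

theorem IsGMatching.card_le_mu {G : SimpleGraph V} {M : Finset (Sym2 V)} (hM : IsGMatching G M) :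
    M.card ≤ mu G :=
  le_csSup ⟨_, card_mem_upperBounds_card_matchings G⟩ ⟨M, ⟨hM, by simp⟩, rfl⟩

/-- A stable set satisfying Hall's condition can be matched into its complement. -/
theorem IsStable.card_le_mu {G : SimpleGraph V} {S : Finset V} (hS : IsStable G S)
    (hall : ∀ A ⊆ S, A.card ≤ (nbhd G A).card) : S.card ≤ mu G := by
  obtain ⟨f, hf, hadj⟩ :=
    (Finset.all_card_le_biUnion_card_iff_exists_injective
      fun s : S => Finset.univ.filter fun v => G.Adj s v).1 (by
        intro A
        have hle := hall (A.map (Function.Embedding.subtype _)) (by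
          intro v hv
          obtain ⟨a, -, rfl⟩ := Finset.mem_map.1 hv
          exact a.2)
        rw [Finset.card_map] at hle
        refine hle.trans (Finset.card_le_card fun v hv => ?_)
        obtain ⟨-, u, hu, huv⟩ := mem_nbhd.1 hv
        obtain ⟨a, ha, rfl⟩ := Finset.mem_map.1 hu
        exact Finset.mem_biUnion.2 ⟨a, ha, by simpa using huv⟩)
  have hadj' : ∀ s : S, G.Adj s (f s) := fun s => by simpa using hadj s
  have hout : ∀ s : S, f s ∉ S := fun s h => hS s.2 h (hadj' s)
  have hshare : ∀ s t : S, ∀ v, v ∈ s(s.1, f s) → v ∈ s(t.1, f t) → s = t := by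
    intro s t v hs ht
    rcases Sym2.mem_iff.1 hs with rfl | rfl <;> rcases Sym2.mem_iff.1 ht with h | h
    · exact Subtype.ext h
    · exact absurd (h ▸ s.2) (hout t)
    · exact absurd (h ▸ t.2) (hout s)
    · exact hf h
  have hinj : Function.Injective fun s : S => s(s.1, f s) := fun s t hst =>
    hshare s t s (Sym2.mem_mk_left _ _)
      ((show s(s.1, f s) = s(t.1, f t) from hst) ▸ Sym2.mem_mk_left _ _)
  have hM : IsGMatching G (Finset.univ.image fun s : S => s(s.1, f s)) := by
    refine ⟨fun e he => ?_, fun e he e' he' hne v hv hv' => hne ?_⟩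
    · obtain ⟨s, -, rfl⟩ := Finset.mem_image.1 he
      exact hadj' s
    · obtain ⟨s, -, rfl⟩ := Finset.mem_image.1 he
      obtain ⟨t, -, rfl⟩ := Finset.mem_image.1 he'
      rw [hshare s t v hv hv']
  have hle := hM.card_le_mu
  rwa [Finset.card_image_of_injective _ hinj, Finset.card_univ, Fintype.card_coe] at hle

theorem WellCovered.alpha_le_mu {G : SimpleGraph V} (hG : WellCovered G)
    (hiso : ∀ v : V, ∃ u, G.Adj v u) : alpha G ≤ mu G := by
  obtain ⟨S, hS, hcard⟩ := exists_isStable_card_eq_alpha G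
  exact hcard ▸ hS.card_le_mu fun A hA => hG.card_le_card_nbhd hiso (hS.mono hA)

/-- `G` is very well-covered iff `G` is a well-covered
König-Egerváry graph without isolated vertices. -/
theorem vwc_iff_wc_ke_no_isolated (G : SimpleGraph V) :
    VeryWellCovered G ↔
      (WellCovered G ∧ KonigEgervary G ∧ ∀ v : V, ∃ u, G.Adj v u) := by
  have hmu := two_mul_mu_le_card G
  constructor
  · rintro ⟨hG, hiso, hcard⟩
    have hle := hG.alpha_le_mu hiso
    refine ⟨hG, ?_, hiso⟩
    unfold KonigEgervary
    omega
  · rintro ⟨hG, hKE, hiso⟩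
    have hle := hG.alpha_le_mu hiso
    refine ⟨hG, hiso, ?_⟩
    unfold KonigEgervary at hKE
    omega
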